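/- Let (p, 0, σ, β) be admissible parameters with x = 0 (so z = p), and suppose 2n − pβ·Σ_{k=1}^{n−1} 1/σ_k² > 0. Then the matrix of the Ricci form of the inner product S(p, 0, σ, β) on 𝔠𝔥(n) is the diagonal matrix Ric = −(1/(2p))·diag((n+1)p, u, u, 2nβ − β²p·Σ_{k=1}^{n−1} 1/σ_k²), where u = (nσ_1 + βp/σ_1, …, nσ_{n−2} + βp/σ_{n−2}, n + βp) ∈ ℝ^{n−1}; in particular all diagonal entries are negative, so the Ricci form is negative definite. -/

import Mathlib

noncomputable section

open Matrix BigOperators Finset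

namespace CHn

/-- Structure constants of the Lie algebra 𝔠𝔥(n) in the ordered basis
`(X, Y_1, …, Y_{n-1}, Z_1, …, Z_{n-1}, W)`:
index `0 ↦ X`, indices `1,…,n-1 ↦ Y_1,…,Y_{n-1}`,
indices `n,…,2n-2 ↦ Z_1,…,Z_{n-1}`, index `2n-1 ↦ W`.
The nonzero brackets are `[X,Y_i] = (1/2)Y_i`, `[X,Z_i] = (1/2)Z_i`,
`[X,W] = W`, `[Z_j,Y_i] = δ_{ij} W`. -/
def structC (n : ℕ) (i j k : Fin (2 * n)) : ℝ :=
  (if i.val = 0 ∧ j = k ∧ 1 ≤ j.val ∧ j.val ≤ 2 * n - 2 then (1 : ℝ) / 2 else 0)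
  - (if j.val = 0 ∧ i = k ∧ 1 ≤ i.val ∧ i.val ≤ 2 * n - 2 then (1 : ℝ) / 2 else 0)
  + (if i.val = 0 ∧ j.val = 2 * n - 1 ∧ k.val = 2 * n - 1 then (1 : ℝ) else 0)
  - (if j.val = 0 ∧ i.val = 2 * n - 1 ∧ k.val = 2 * n - 1 then (1 : ℝ) else 0)
  + (if n ≤ i.val ∧ i.val ≤ 2 * n - 2 ∧ i.val = j.val + (n - 1) ∧ k.val = 2 * n - 1
      then (1 : ℝ) else 0)
  - (if n ≤ j.val ∧ j.val ≤ 2 * n - 2 ∧ j.val = i.val + (n - 1) ∧ k.val = 2 * n - 1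
      then (1 : ℝ) else 0)

/-- The Lie bracket of `𝔠𝔥(n)`, as a bilinear operation on coordinate vectors. -/
def bracket (n : ℕ) (u v : Fin (2 * n) → ℝ) : Fin (2 * n) → ℝ :=
  fun k => ∑ i, ∑ j, u i * v j * structC n i j k

/-- `F` is the matrix (in the ordered basis) of a Lie algebra automorphism of `𝔠𝔥(n)`. -/
def IsAut (n : ℕ) (F : Matrix (Fin (2 * n)) (Fin (2 * n)) ℝ) : Prop :=
  IsUnit F ∧ ∀ u v, F.mulVec (bracket n u v) = bracket n (F.mulVec u) (F.mulVec v)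

/-- The normal form `S(p, x, σ, β)`: the block matrix
`[[p, xᵀ, 0, 0], [x, σ, 0, 0], [0, 0, σ, 0], [0, 0, 0, β]]`
with blocks of sizes `1, n-1, n-1, 1`. -/
def Sform (n : ℕ) (p : ℝ) (x σ : Fin (n - 1) → ℝ) (β : ℝ) :
    Matrix (Fin (2 * n)) (Fin (2 * n)) ℝ := fun i j =>
  if i.val = 0 ∧ j.val = 0 then p
  else if h : i.val = 0 ∧ 1 ≤ j.val ∧ j.val ≤ n - 1 then x ⟨j.val - 1, by omega⟩
  else if h : j.val = 0 ∧ 1 ≤ i.val ∧ i.val ≤ n - 1 then x ⟨i.val - 1, by omega⟩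
  else if h : i = j ∧ 1 ≤ i.val ∧ i.val ≤ n - 1 then σ ⟨i.val - 1, by omega⟩
  else if h : i = j ∧ n ≤ i.val ∧ i.val ≤ 2 * n - 2 then σ ⟨i.val - n, by omega⟩
  else if i = j ∧ i.val = 2 * n - 1 then β
  else 0

/-- Admissibility of the parameters `(p, x, σ, β)`:
`p, β > 0`, all `x_i ≥ 0`, `σ_1 ≥ … ≥ σ_{n-2} ≥ 1` and the convention `σ_{n-1} = 1`. -/
def Admissible (n : ℕ) (p : ℝ) (x σ : Fin (n - 1) → ℝ) (β : ℝ) : Prop :=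
  0 < p ∧ 0 < β ∧ (∀ i, 0 ≤ x i) ∧ Antitone σ ∧ (∀ i, 1 ≤ σ i) ∧
    ∀ _h : 1 ≤ n - 1, σ ⟨n - 2, by omega⟩ = 1

/-- `z = p - Σ_i x_i² / σ_i`. -/
def zval (n : ℕ) (p : ℝ) (x σ : Fin (n - 1) → ℝ) : ℝ :=
  p - ∑ i, (x i) ^ 2 / σ i

/-- The inner product on `𝔠𝔥(n)` determined by a matrix `S`. -/
def ip (n : ℕ) (S : Matrix (Fin (2 * n)) (Fin (2 * n)) ℝ) (u v : Fin (2 * n) → ℝ) : ℝ :=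
  u ⬝ᵥ S.mulVec v

/-- The coordinates (w.r.t. the standard basis) of the Koszul form
`K(u,v)(T) = ⟨[u,v],T⟩ - ⟨[v,T],u⟩ + ⟨[T,u],v⟩`. -/
def koszul (n : ℕ) (S : Matrix (Fin (2 * n)) (Fin (2 * n)) ℝ)
    (u v : Fin (2 * n) → ℝ) : Fin (2 * n) → ℝ := fun t =>
  ip n S (bracket n u v) (Pi.single t 1) - ip n S (bracket n v (Pi.single t 1)) u
    + ip n S (bracket n (Pi.single t 1) u) v

/-- The Levi-Civita product `∇_u v` of the inner product `S`,
i.e. the unique solution of the Koszul formula `2⟨∇_u v, T⟩ = K(u,v)(T)`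
(for invertible symmetric `S`). -/
def nabla (n : ℕ) (S : Matrix (Fin (2 * n)) (Fin (2 * n)) ℝ)
    (u v : Fin (2 * n) → ℝ) : Fin (2 * n) → ℝ :=
  (2 : ℝ)⁻¹ • (S⁻¹).mulVec (koszul n S u v)

/-- The curvature operator `R(u,v)w = ∇_u∇_v w - ∇_v∇_u w - ∇_{[u,v]} w`. -/
def curv (n : ℕ) (S : Matrix (Fin (2 * n)) (Fin (2 * n)) ℝ)
    (u v w : Fin (2 * n) → ℝ) : Fin (2 * n) → ℝ :=
  nabla n S u (nabla n S v w) - nabla n S v (nabla n S u w) - nabla n S (bracket n u v) w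

/-- The Ricci form `Ric(u,v) = tr (T ↦ R(T,u)v)`. -/
def ricci (n : ℕ) (S : Matrix (Fin (2 * n)) (Fin (2 * n)) ℝ)
    (u v : Fin (2 * n) → ℝ) : ℝ :=
  ∑ t, curv n S (Pi.single t 1) u v t

/-- The scalar curvature `τ = Σ_{i,j} g^{ij} Ric(e_i, e_j)`. -/
def scalarCurv (n : ℕ) (S : Matrix (Fin (2 * n)) (Fin (2 * n)) ℝ) : ℝ :=
  ∑ i, ∑ j, (S⁻¹) i j * ricci n S (Pi.single i 1) (Pi.single j 1)

/-- The wedge endomorphism `(u∧v)(w) = ⟨v,w⟩u - ⟨u,w⟩v`. -/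
def wedge (n : ℕ) (S : Matrix (Fin (2 * n)) (Fin (2 * n)) ℝ)
    (u v : Fin (2 * n) → ℝ) : (Fin (2 * n) → ℝ) → (Fin (2 * n) → ℝ) :=
  fun w => ip n S v w • u - ip n S u w • v

/-- The standard symplectic matrix `J_m = [[0, I_m], [-I_m, 0]]`. -/
def Jmat (m : ℕ) : Matrix (Fin (2 * m)) (Fin (2 * m)) ℝ := fun i j =>
  if j.val = i.val + m then 1 else if i.val = j.val + m then -1 else 0

/-- The block matrix `[[1, 0, 0], [u, M, 0], [a, vᵀ, λ]]`
with blocks of sizes `1, 2n-2, 1`. -/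
def blockF (n : ℕ) (M : Matrix (Fin (2 * (n - 1))) (Fin (2 * (n - 1))) ℝ)
    (u v : Fin (2 * (n - 1)) → ℝ) (a lam : ℝ) :
    Matrix (Fin (2 * n)) (Fin (2 * n)) ℝ := fun i j =>
  if i.val = 0 then (if j.val = 0 then 1 else 0)
  else if h : 1 ≤ i.val ∧ i.val ≤ 2 * n - 2 then
    (if j.val = 0 then u ⟨i.val - 1, by omega⟩
     else if h2 : 1 ≤ j.val ∧ j.val ≤ 2 * n - 2 then
       M ⟨i.val - 1, by omega⟩ ⟨j.val - 1, by omega⟩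
     else 0)
  else
    (if j.val = 0 then a
     else if h2 : 1 ≤ j.val ∧ j.val ≤ 2 * n - 2 then v ⟨j.val - 1, by omega⟩
     else lam)

/-- The metric is Einstein: the Ricci form is proportional to the inner product. -/
def IsEinstein (n : ℕ) (S : Matrix (Fin (2 * n)) (Fin (2 * n)) ℝ) : Prop :=
  ∃ c : ℝ, ∀ u v, ricci n S u v = c * ip n S u v

end CHn

namespace CHn

def iX (m : ℕ) : Fin (2 * (m + 1)) := ⟨0, by omega⟩
def iY {m : ℕ} (k : Fin m) : Fin (2 * (m + 1)) := ⟨k.val + 1, by omega⟩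
def iZ {m : ℕ} (k : Fin m) : Fin (2 * (m + 1)) := ⟨k.val + (m + 1), by omega⟩
def iW (m : ℕ) : Fin (2 * (m + 1)) := ⟨2 * m + 1, by omega⟩

lemma idx_cases {m : ℕ} (t : Fin (2 * (m + 1))) :
    t = iX m ∨ (∃ k, t = iY k) ∨ (∃ k, t = iZ k) ∨ t = iW m := by
  rcases t with ⟨t, ht⟩
  by_cases h0 : t = 0
  · left; simp [iX, h0]
  by_cases h1 : t ≤ m
  · right; left; exact ⟨⟨t - 1, by omega⟩, by simp [iY, Fin.ext_iff]; omega⟩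
  by_cases h2 : t ≤ 2 * m
  · right; right; left; exact ⟨⟨t - (m + 1), by omega⟩, by simp [iZ, Fin.ext_iff]; omega⟩
  · right; right; right; simp [iW, Fin.ext_iff]; omega

lemma sum_idx {m : ℕ} (f : Fin (2 * (m + 1)) → ℝ) :
    ∑ t, f t = f (iX m) + ∑ k, f (iY k) + ∑ k, f (iZ k) + f (iW m) := by
  have e : (m + m) + 1 + 1 = 2 * (m + 1) := by ring
  rw [← Equiv.sum_comp (finCongr e) f, Fin.sum_univ_castSucc, Fin.sum_univ_succ, Fin.sum_univ_add]
  rw [← add_assoc]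
  congr 1
  · congr 1
    congr 1
    funext k
    apply congrArg f
    simp [iZ, Fin.ext_iff]; omega
  · apply congrArg f
    simp [iW, Fin.ext_iff]
    try omega

lemma ne_XY {m : ℕ} (l : Fin m) : (iX m = iY l) = False := by
  simp only [iX, iY, Fin.ext_iff, eq_iff_iff, iff_false]; omega
lemma ne_XZ {m : ℕ} (l : Fin m) : (iX m = iZ l) = False := by
  simp only [iX, iZ, Fin.ext_iff, eq_iff_iff, iff_false]; omega
lemma ne_XW (m : ℕ) : (iX m = iW m) = False := by
  simp only [iX, iW, Fin.ext_iff, eq_iff_iff, iff_false]; omega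
lemma ne_YX {m : ℕ} (k : Fin m) : (iY k = iX m) = False := by
  simp only [iY, iX, Fin.ext_iff, eq_iff_iff, iff_false]; omega
lemma ne_YZ {m : ℕ} (k : Fin m) (l : Fin m) : (iY k = iZ l) = False := by
  simp only [iY, iZ, Fin.ext_iff, eq_iff_iff, iff_false]; omega
lemma ne_YW {m : ℕ} (k : Fin m) : (iY k = iW m) = False := by
  simp only [iY, iW, Fin.ext_iff, eq_iff_iff, iff_false]; omega
lemma ne_ZX {m : ℕ} (k : Fin m) : (iZ k = iX m) = False := by
  simp only [iZ, iX, Fin.ext_iff, eq_iff_iff, iff_false]; omega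
lemma ne_ZY {m : ℕ} (k : Fin m) (l : Fin m) : (iZ k = iY l) = False := by
  simp only [iZ, iY, Fin.ext_iff, eq_iff_iff, iff_false]; omega
lemma ne_ZW {m : ℕ} (k : Fin m) : (iZ k = iW m) = False := by
  simp only [iZ, iW, Fin.ext_iff, eq_iff_iff, iff_false]; omega
lemma ne_WX (m : ℕ) : (iW m = iX m) = False := by
  simp only [iW, iX, Fin.ext_iff, eq_iff_iff, iff_false]; omega
lemma ne_WY {m : ℕ} (l : Fin m) : (iW m = iY l) = False := by
  simp only [iW, iY, Fin.ext_iff, eq_iff_iff, iff_false]; omega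
lemma ne_WZ {m : ℕ} (l : Fin m) : (iW m = iZ l) = False := by
  simp only [iW, iZ, Fin.ext_iff, eq_iff_iff, iff_false]; omega
lemma iY_inj {m : ℕ} (k l : Fin m) : iY k = iY l ↔ k = l := by
  simp [iY, Fin.ext_iff]
lemma iZ_inj {m : ℕ} (k l : Fin m) : iZ k = iZ l ↔ k = l := by
  simp [iZ, Fin.ext_iff]

/-- vector from its four blocks -/
def vec {m : ℕ} (x : ℝ) (y z : Fin m → ℝ) (w : ℝ) : Fin (2 * (m + 1)) → ℝ := fun t =>
  (if t = iX m then x else 0) + ∑ k, (if t = iY k then y k else 0)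
    + ∑ k, (if t = iZ k then z k else 0) + (if t = iW m then w else 0)

section
variable {m : ℕ} (u v : Fin (2 * (m + 1)) → ℝ)

lemma br_X : bracket (m + 1) u v (iX m) = 0 := by
  unfold bracket
  refine Finset.sum_eq_zero fun i _ => Finset.sum_eq_zero fun j _ => ?_
  have : structC (m + 1) i j (iX m) = 0 := by
    have h1 : ¬ (0 = 2 * (m + 1) - 1) := by omega
    have h2 : ∀ a : ℕ, ¬ (a = 0 ∧ 1 ≤ a ∧ a ≤ 2 * (m + 1) - 2) := by omega
    simp only [structC, iX, Fin.ext_iff, h1, h2, and_false, if_false]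
    norm_num
  rw [this, mul_zero]

lemma br_Y (k : Fin m) : bracket (m + 1) u v (iY k) =
    (u (iX m) * v (iY k) - v (iX m) * u (iY k)) / 2 := by
  have : ∀ i j, structC (m + 1) i j (iY k) =
      (if i = iX m then if j = iY k then 1 / 2 else 0 else 0) -
      (if j = iX m then if i = iY k then 1 / 2 else 0 else 0) := by
    intro i j
    have h1 : ¬ (k.val + 1 = 2 * (m + 1) - 1) := by omega
    have h2 : ∀ a : ℕ, (a = k.val + 1 ∧ 1 ≤ a ∧ a ≤ 2 * (m + 1) - 2) ↔ a = k.val + 1 := by omega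
    simp only [structC, iX, iY, Fin.ext_iff, h1, h2, and_false, if_false, ← ite_and]
    ring
  simp only [bracket, this, mul_sub, Finset.sum_sub_distrib, mul_ite, mul_zero]
  simp
  ring

lemma br_Z (k : Fin m) : bracket (m + 1) u v (iZ k) =
    (u (iX m) * v (iZ k) - v (iX m) * u (iZ k)) / 2 := by
  have : ∀ i j, structC (m + 1) i j (iZ k) =
      (if i = iX m then if j = iZ k then 1 / 2 else 0 else 0) -
      (if j = iX m then if i = iZ k then 1 / 2 else 0 else 0) := by
    intro i j
    have h1 : ¬ (k.val + (m + 1) = 2 * (m + 1) - 1) := by omega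
    have h2 : ∀ a : ℕ, (a = k.val + (m + 1) ∧ 1 ≤ a ∧ a ≤ 2 * (m + 1) - 2) ↔ a = k.val + (m + 1) := by omega
    simp only [structC, iX, iZ, Fin.ext_iff, h1, h2, and_false, if_false, ← ite_and]
    ring
  simp only [bracket, this, mul_sub, Finset.sum_sub_distrib, mul_ite, mul_zero]
  simp
  ring

lemma br_W : bracket (m + 1) u v (iW m) =
    u (iX m) * v (iW m) - v (iX m) * u (iW m) +
      ∑ k, (u (iZ k) * v (iY k) - u (iY k) * v (iZ k)) := by
  have h : ∀ i j, structC (m + 1) i j (iW m) =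
      (if i = iX m then if j = iW m then 1 else 0 else 0) -
      (if j = iX m then if i = iW m then 1 else 0 else 0) +
      ∑ k : Fin m, ((if i = iZ k then if j = iY k then 1 else 0 else 0) - 
        (if j = iZ k then if i = iY k then 1 else 0 else 0)) := by
    intro i j
    have aux : ∀ i j : Fin (2 * (m + 1)), 
        ∑ k : Fin m, (if i = iZ k then if j = iY k then (1:ℝ) else 0 else 0) = 
        if m + 1 ≤ i.val ∧ i.val ≤ 2 * (m + 1) - 2 ∧ i.val = j.val + (m + 1 - 1) then 1 else 0 := by
      intro i j
      split_ifs with hc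
      · rw [Finset.sum_eq_single (⟨j.val - 1, by omega⟩ : Fin m)]
        · rw [if_pos (by simp only [iZ, Fin.ext_iff]; omega), if_pos (by simp only [iY, Fin.ext_iff]; omega)]
        · intro b _ hb
          rw [← ite_and, if_neg]
          simp only [iZ, iY, Fin.ext_iff, ne_eq] at *
          omega
        · simp
      · refine Finset.sum_eq_zero fun b _ => ?_
        rw [← ite_and, if_neg]
        simp only [iZ, iY, Fin.ext_iff] at *
        omega
    rw [Finset.sum_sub_distrib, aux, aux]
    simp only [structC, iX, iW, Fin.ext_iff, ← ite_and]
    grind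
  simp only [bracket, h, mul_add, mul_sub, Finset.sum_sub_distrib, Finset.sum_add_distrib, mul_ite, mul_zero, Finset.mul_sum]
  have sw : ∀ f : Fin (2*(m+1)) → Fin (2*(m+1)) → Fin m → ℝ,
      ∑ i, ∑ j, ∑ k, f i j k = ∑ k, ∑ i, ∑ j, f i j k := by
    intro f
    rw [Finset.sum_congr rfl fun i _ => Finset.sum_comm]
    exact Finset.sum_comm
  simp only [sw]
  simp
  ring

variable (p β : ℝ) (σ : Fin m → ℝ)

def gd : Fin (2 * (m + 1)) → ℝ := vec p σ σ β

lemma vec_X (x : ℝ) (y z : Fin m → ℝ) (w : ℝ) : vec x y z w (iX m) = x := by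
  simp [vec, iY_inj, iZ_inj, ne_XY, ne_XZ, ne_XW, ne_YX, ne_YZ, ne_YW, ne_ZX, ne_ZY, ne_ZW, ne_WX, ne_WY, ne_WZ]
lemma vec_Y (x : ℝ) (y z : Fin m → ℝ) (w : ℝ) (k) : vec x y z w (iY k) = y k := by
  simp [vec, iY_inj, iZ_inj, ne_XY, ne_XZ, ne_XW, ne_YX, ne_YZ, ne_YW, ne_ZX, ne_ZY, ne_ZW, ne_WX, ne_WY, ne_WZ]
lemma vec_Z (x : ℝ) (y z : Fin m → ℝ) (w : ℝ) (k) : vec x y z w (iZ k) = z k := by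
  simp [vec, iY_inj, iZ_inj, ne_XY, ne_XZ, ne_XW, ne_YX, ne_YZ, ne_YW, ne_ZX, ne_ZY, ne_ZW, ne_WX, ne_WY, ne_WZ]
lemma vec_W (x : ℝ) (y z : Fin m → ℝ) (w : ℝ) : vec x y z w (iW m) = w := by
  simp [vec, iY_inj, iZ_inj, ne_XY, ne_XZ, ne_XW, ne_YX, ne_YZ, ne_YW, ne_ZX, ne_ZY, ne_ZW, ne_WX, ne_WY, ne_WZ]

lemma Sform_eq : Sform (m + 1) p 0 σ β = Matrix.diagonal (gd p β σ) := by
  ext i j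
  by_cases hij : i = j
  · subst hij
    rw [Matrix.diagonal_apply_eq]
    rcases idx_cases i with rfl | ⟨k, rfl⟩ | ⟨k, rfl⟩ | rfl
    · rw [gd, vec_X]; simp [Sform, iX]
    · rw [gd, vec_Y]; simp [Sform, iY]
    · rw [gd, vec_Z]; simp only [Sform, iZ]; 
      rw [if_neg (by omega), dif_neg (by omega), dif_neg (by omega), dif_neg (by simp only [true_and]; omega), dif_pos (by simp only [true_and]; omega)]
      congr 1; simp
    · rw [gd, vec_W]; simp only [Sform, iW]; 
      rw [if_neg (by omega), dif_neg (by omega), dif_neg (by omega), dif_neg (by simp only [true_and]; omega), dif_neg (by simp only [true_and]; omega), if_pos (by simp only [true_and]; omega)]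
  · rw [Matrix.diagonal_apply_ne _ hij]
    have h2 : ¬ i.val = j.val := by rwa [← Fin.ext_iff]
    simp only [Sform]
    rw [if_neg (by omega)]
    simp [hij]

variable (hp : 0 < p) (hβ : 0 < β) (hσ : ∀ k, 0 < σ k)

lemma gd_pos (hp : 0 < p) (hβ : 0 < β) (hσ : ∀ k, 0 < σ k) (t) : 0 < gd p β σ t := by
  rcases idx_cases t with rfl | ⟨k, rfl⟩ | ⟨k, rfl⟩ | rfl
  · rwa [gd, vec_X]
  · rw [gd, vec_Y]; apply hσ
  · rw [gd, vec_Z]; apply hσ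
  · rwa [gd, vec_W]

lemma nab_eq (hp : 0 < p) (hβ : 0 < β) (hσ : ∀ k, 0 < σ k) (t) :
    nabla (m + 1) (Sform (m + 1) p 0 σ β) u v t =
      (gd p β σ t)⁻¹ / 2 * koszul (m + 1) (Sform (m + 1) p 0 σ β) u v t := by
  have : (Sform (m + 1) p 0 σ β)⁻¹ = Matrix.diagonal (fun t => (gd p β σ t)⁻¹) := by
    rw [Sform_eq]
    apply Matrix.inv_eq_right_inv
    rw [Matrix.diagonal_mul_diagonal, ← Matrix.diagonal_one]
    congr 1
    ext t
    exact mul_inv_cancel₀ (gd_pos p β σ hp hβ hσ t).ne'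
  simp only [nabla, this, Pi.smul_apply, Matrix.mulVec_diagonal, smul_eq_mul]
  ring

lemma ip_eq : ip (m + 1) (Sform (m + 1) p 0 σ β) u v =
    p * (u (iX m) * v (iX m)) + ∑ k, σ k * (u (iY k) * v (iY k)) +
     ∑ k, σ k * (u (iZ k) * v (iZ k)) + β * (u (iW m) * v (iW m)) := by
  simp only [ip, Sform_eq, dotProduct, Matrix.mulVec_diagonal, sum_idx, gd, vec_X, vec_Y, vec_Z, vec_W]
  simp only [mul_left_comm]

lemma nab_X (hp : 0 < p) (hβ : 0 < β) (hσ : ∀ k, 0 < σ k) :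
    nabla (m + 1) (Sform (m + 1) p 0 σ β) u v (iX m) =
      (1 / (2 * p)) * (∑ k, σ k * (u (iY k) * v (iY k) + u (iZ k) * v (iZ k))
        + 2 * β * (u (iW m) * v (iW m))) := by
  rw [nab_eq u v p β σ hp hβ hσ, koszul]
  simp only [ip_eq, br_X, br_Y, br_Z, br_W, gd, vec_X, Pi.single_apply, ne_XY, ne_XZ, ne_XW, ne_YX, ne_YZ, ne_YW, ne_ZX, ne_ZY, ne_ZW, ne_WX, ne_WY, ne_WZ, if_true, if_false]
  simp
  simp only [← Finset.sum_add_distrib, mul_add]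
  have e : ∀ k, σ k * (u (iY k) * v (iY k)) = σ k * (-v (iY k) / 2 * u (iY k)) * (-1) + σ k * (u (iY k) / 2 * v (iY k)) := by intro k; ring
  have e' : ∀ k, σ k * (u (iZ k) * v (iZ k)) = σ k * (-v (iZ k) / 2 * u (iZ k)) * (-1) + σ k * (u (iZ k) / 2 * v (iZ k)) := by intro k; ring
  simp only [e, e', Finset.sum_add_distrib, ← Finset.sum_mul]
  field_simp
  ring

lemma nab_Y (hp : 0 < p) (hβ : 0 < β) (hσ : ∀ k, 0 < σ k) (k : Fin m) :
    nabla (m + 1) (Sform (m + 1) p 0 σ β) u v (iY k) =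
      - v (iX m) * u (iY k) / 2 - β / (2 * σ k) * (u (iW m) * v (iZ k) + v (iW m) * u (iZ k)) := by
  rw [nab_eq u v p β σ hp hβ hσ, koszul]
  have := (hσ k).ne'
  simp only [ip_eq, br_X, br_Y, br_Z, br_W, gd, vec_Y, Pi.single_apply, ne_XY, ne_XZ, ne_XW, ne_YX, ne_YZ, ne_YW, ne_ZX, ne_ZY, ne_ZW, ne_WX, ne_WY, ne_WZ, iY_inj, if_true, if_false]
  simp [neg_div, ite_div]
  field_simp
  ring

lemma nab_Z (hp : 0 < p) (hβ : 0 < β) (hσ : ∀ k, 0 < σ k) (k : Fin m) :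
    nabla (m + 1) (Sform (m + 1) p 0 σ β) u v (iZ k) =
      - v (iX m) * u (iZ k) / 2 + β / (2 * σ k) * (u (iW m) * v (iY k) + v (iW m) * u (iY k)) := by
  rw [nab_eq u v p β σ hp hβ hσ, koszul]
  have := (hσ k).ne'
  simp only [ip_eq, br_X, br_Y, br_Z, br_W, gd, vec_Z, Pi.single_apply, ne_XY, ne_XZ, ne_XW, ne_YX, ne_YZ, ne_YW, ne_ZX, ne_ZY, ne_ZW, ne_WX, ne_WY, ne_WZ, iZ_inj, if_true, if_false]
  simp [neg_div, ite_div]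
  field_simp
  ring

lemma nab_W (hp : 0 < p) (hβ : 0 < β) (hσ : ∀ k, 0 < σ k) :
    nabla (m + 1) (Sform (m + 1) p 0 σ β) u v (iW m) =
      - v (iX m) * u (iW m) + (∑ k, (u (iZ k) * v (iY k) - u (iY k) * v (iZ k))) / 2 := by
  rw [nab_eq u v p β σ hp hβ hσ, koszul]
  simp only [ip_eq, br_X, br_Y, br_Z, br_W, gd, vec_W, Pi.single_apply, ne_XY, ne_XZ, ne_XW, ne_YX, ne_YZ, ne_YW, ne_ZX, ne_ZY, ne_ZW, ne_WX, ne_WY, ne_WZ, if_true, if_false]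
  simp
  field_simp
  ring

lemma ricci_eq (hp : 0 < p) (hβ : 0 < β) (hσ : ∀ k, 0 < σ k) :
    ricci (m + 1) (Sform (m + 1) p 0 σ β) u v =
      -(1 / (2 * p)) * (((m : ℝ) + 2) * p * (u (iX m) * v (iX m))
        + ∑ k, (((m : ℝ) + 1) * σ k + β * p / σ k) * (u (iY k) * v (iY k))
        + ∑ k, (((m : ℝ) + 1) * σ k + β * p / σ k) * (u (iZ k) * v (iZ k))
        + (2 * ((m : ℝ) + 1) * β - β ^ 2 * p * ∑ k, 1 / (σ k) ^ 2) * (u (iW m) * v (iW m))) := by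
  simp only [ricci, curv, Pi.sub_apply, sum_idx, nab_X _ _ p β σ hp hβ hσ, nab_Y _ _ p β σ hp hβ hσ,
    nab_Z _ _ p β σ hp hβ hσ, nab_W _ _ p β σ hp hβ hσ, br_X, br_Y, br_Z, br_W, Pi.single_apply,
    ne_XY, ne_XZ, ne_XW, ne_YX, ne_YZ, ne_YW, ne_ZX, ne_ZY, ne_ZW, ne_WX, ne_WY, ne_WZ, iY_inj, iZ_inj, if_true, if_false]
  simp
  have hs : ∀ k, σ k ≠ 0 := fun k => (hσ k).ne'
  set x := u (iX m)
  set x' := v (iX m)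
  set w := u (iW m)
  set w' := v (iW m)
  set y : Fin m → ℝ := fun k => u (iY k) with hy
  set y' : Fin m → ℝ := fun k => v (iY k) with hy'
  set z : Fin m → ℝ := fun k => u (iZ k) with hz
  set z' : Fin m → ℝ := fun k => v (iZ k) with hz'
  have ey : ∀ k, u (iY k) = y k := fun _ => rfl
  have ey' : ∀ k, v (iY k) = y' k := fun _ => rfl
  have ez : ∀ k, u (iZ k) = z k := fun _ => rfl
  have ez' : ∀ k, v (iZ k) = z' k := fun _ => rfl
  clear_value x x' w w' y y' z z'
  simp only [ey, ey', ez, ez']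
  clear ey ey' ez ez'
  obtain ⟨A, hA⟩ : ∃ A, A = ∑ k, σ k * (y k * y' k) := ⟨_, rfl⟩
  obtain ⟨B, hB⟩ : ∃ A, A = ∑ k, σ k * (z k * z' k) := ⟨_, rfl⟩
  obtain ⟨C, hC⟩ : ∃ A, A = ∑ k, (σ k)⁻¹ * (y k * y' k) := ⟨_, rfl⟩
  obtain ⟨D, hD⟩ : ∃ A, A = ∑ k, (σ k)⁻¹ * (z k * z' k) := ⟨_, rfl⟩
  obtain ⟨E, hE⟩ : ∃ A, A = ∑ k, ((σ k) ^ 2)⁻¹ := ⟨_, rfl⟩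
  have S1 : ∑ k, σ k * (y k / 2 * y' k + z k / 2 * z' k) = 1 / 2 * A + 1 / 2 * B := by
    rw [hA, hB, Finset.mul_sum, Finset.mul_sum, ← Finset.sum_add_distrib]
    exact Finset.sum_congr rfl fun k _ => by ring
  have S2 : ∑ k, σ k * (y k * y' k + z k * z' k) = A + B := by
    rw [hA, hB, ← Finset.sum_add_distrib]
    exact Finset.sum_congr rfl fun k _ => by ring
  have S3 : ∑ k, -(p⁻¹ * 2⁻¹ * (σ k * y' k) * y k) / 2 = (-p⁻¹ / 4) * A := by
    rw [hA, Finset.mul_sum]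
    exact Finset.sum_congr rfl fun k _ => by ring
  have S4 : ∑ k, β / (2 * σ k) * (w * (β / (2 * σ k) * w') + -z' k / 2 * z k) =
      (β ^ 2 / 4 * w * w') * E + (-β / 4) * D := by
    rw [hE, hD, Finset.mul_sum, Finset.mul_sum, ← Finset.sum_add_distrib]
    exact Finset.sum_congr rfl fun k _ => by have := hs k; field_simp; ring
  have S5 : ∀ a b : Fin m → ℝ, ∑ k, (-(x' * (-x / 2)) / 2 + β / (2 * σ k) * (a k * b k)) =
      m * (x * x' / 4) + β / 2 * ∑ k, (σ k)⁻¹ * (a k * b k) := by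
    intro a b
    rw [Finset.sum_add_distrib, Finset.mul_sum]
    congr 1
    · rw [Finset.sum_const, Finset.card_univ, Fintype.card_fin, nsmul_eq_mul]; ring
    · exact Finset.sum_congr rfl fun k _ => by have := hs k; field_simp
  have S6 : ∑ k, (-(p⁻¹ * 2⁻¹ * (σ k * z' k) * z k) / 2 +
        β / (2 * σ k) * (-(w * (β / (2 * σ k) * w')) + y' k / 2 * y k)) =
      (-p⁻¹ / 4) * B + (-β ^ 2 / 4 * w * w') * E + (β / 4) * C := by
    rw [hB, hE, hC, Finset.mul_sum, Finset.mul_sum, Finset.mul_sum, ← Finset.sum_add_distrib,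
      ← Finset.sum_add_distrib]
    exact Finset.sum_congr rfl fun k _ => by have := hs k; field_simp; ring
  have S8 : ∀ a b : Fin m → ℝ, ∑ k, a k * (β / (2 * σ k) * b k) =
      β / 2 * ∑ k, (σ k)⁻¹ * (a k * b k) := by
    intro a b
    rw [Finset.mul_sum]
    exact Finset.sum_congr rfl fun k _ => by have := hs k; field_simp
  have S10 : ∀ a b : Fin m → ℝ, ∑ k, (((m : ℝ) + 1) * σ k + β * p / σ k) * (a k * b k) =
      (m + 1) * ∑ k, σ k * (a k * b k) + (β * p) * ∑ k, (σ k)⁻¹ * (a k * b k) := by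
    intro a b
    rw [Finset.mul_sum, Finset.mul_sum, ← Finset.sum_add_distrib]
    exact Finset.sum_congr rfl fun k _ => by have := hs k; field_simp
  rw [S1, S2, S3, S4, S5, S5, S6, S8, S8, S10, S10, ← hA, ← hB, ← hC, ← hD, ← hE]
  field_simp
  ring

end

/-- For `x = 0` and `2n - pβ Σ_k σ_k⁻² > 0`, the Ricci form of `g(p,0,σ,β)` is the
diagonal matrix `-(1/(2p)) diag((n+1)p, u, u, 2nβ - β²p Σ_k σ_k⁻²)` with
`u_i = nσ_i + βp/σ_i` (and `u_{n-1} = n + βp`); all diagonal entries are negative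
and the Ricci form is negative definite. -/
theorem ricci_neg_definite (n : ℕ) (hn : 2 ≤ n) (p β : ℝ) (σ : Fin (n - 1) → ℝ)
    (hadm : Admissible n p 0 σ β)
    (hcond : 0 < 2 * (n : ℝ) - p * β * ∑ k, 1 / (σ k) ^ 2) :
    let S := Sform n p 0 σ β
    let d : Fin (2 * n) → ℝ := fun i =>
      -(1 / (2 * p)) *
        (if i.val = 0 then ((n : ℝ) + 1) * p
         else if h : 1 ≤ i.val ∧ i.val ≤ n - 1 then
           (n : ℝ) * σ ⟨i.val - 1, by omega⟩ + β * p / σ ⟨i.val - 1, by omega⟩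
         else if h : n ≤ i.val ∧ i.val ≤ 2 * n - 2 then
           (n : ℝ) * σ ⟨i.val - n, by omega⟩ + β * p / σ ⟨i.val - n, by omega⟩
         else 2 * (n : ℝ) * β - β ^ 2 * p * ∑ k, 1 / (σ k) ^ 2)
    (∀ i j, ricci n S (Pi.single i 1) (Pi.single j 1) = if i = j then d i else 0) ∧
    (∀ i, d i < 0) ∧
    (∀ u : Fin (2 * n) → ℝ, u ≠ 0 → ricci n S u u < 0) := by
  obtain ⟨m, rfl⟩ : ∃ m, n = m + 1 := ⟨n - 1, by omega⟩
  change Fin m → ℝ at σ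
  obtain ⟨hp, hβ, -, -, hσ1, -⟩ := hadm
  have hσ : ∀ k : Fin m, 0 < σ k := fun k => lt_of_lt_of_le one_pos (hσ1 k)
  intro S d
  obtain ⟨E, hE⟩ : ∃ E, E = ∑ k : Fin m, 1 / (σ k) ^ 2 := ⟨_, rfl⟩
  have hE' : ∑ k : Fin (m + 1 - 1), 1 / (σ k) ^ 2 = E := hE.symm
  have dX : d (iX m) = -(1 / (2 * p)) * (((m : ℝ) + 2) * p) := by
    simp only [d, iX, if_true]; push_cast; ring
  have dY : ∀ k, d (iY k) = -(1 / (2 * p)) * (((m : ℝ) + 1) * σ k + β * p / σ k) := by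
    intro k
    simp only [d, iY]
    rw [if_neg (by omega), dif_pos (by omega)]
    push_cast
    rfl
  have dZ : ∀ k, d (iZ k) = -(1 / (2 * p)) * (((m : ℝ) + 1) * σ k + β * p / σ k) := by
    intro k
    simp only [d, iZ]
    rw [if_neg (by omega), dif_neg (by omega), dif_pos (by omega)]
    simp
  have dW : d (iW m) = -(1 / (2 * p)) * (2 * ((m : ℝ) + 1) * β - β ^ 2 * p * E) := by
    simp only [d, iW]
    rw [if_neg (by omega), dif_neg (by omega), dif_neg (by omega), hE']
    push_cast
    rfl
  have key : ∀ u v, ricci (m + 1) S u v = ∑ t, d t * (u t * v t) := by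
    intro u v
    rw [sum_idx]
    simp only [S, dX, dY, dZ, dW]
    rw [ricci_eq u v p β σ hp hβ hσ, ← hE]
    simp only [mul_assoc (-(1 / (2 * p)))]
    simp only [← Finset.mul_sum]
    ring
  have hneg : ∀ i, d i < 0 := by
    have h2 : -(1 / (2 * p)) < 0 := by
      have : 0 < 1 / (2 * p) := by positivity
      linarith
    rw [hE'] at hcond
    push_cast at hcond
    intro i
    rcases idx_cases i with rfl | ⟨k, rfl⟩ | ⟨k, rfl⟩ | rfl
    · rw [dX]; exact mul_neg_of_neg_of_pos h2 (by positivity)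
    · rw [dY]; have := hσ k; exact mul_neg_of_neg_of_pos h2 (by positivity)
    · rw [dZ]; have := hσ k; exact mul_neg_of_neg_of_pos h2 (by positivity)
    · rw [dW]; refine mul_neg_of_neg_of_pos h2 ?_
      have := mul_pos hβ hcond
      nlinarith
  refine ⟨?_, hneg, ?_⟩
  · intro i j
    rw [key, Finset.sum_eq_single i]
    · simp [Pi.single_apply]
    · intro b _ hb
      simp [Pi.single_apply, hb]
    · simp
  · intro u hu
    obtain ⟨i, hi⟩ := Function.ne_iff.mp hu
    rw [key]
    refine Finset.sum_neg' (fun t _ => ?_) ⟨i, Finset.mem_univ _, ?_⟩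
    · exact mul_nonpos_of_nonpos_of_nonneg (hneg t).le (mul_self_nonneg _)
    · exact mul_neg_of_neg_of_pos (hneg i) (mul_self_pos.mpr hi)

end CHn
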